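/- arXiv:1503.05510 — 2 statements merged into one kernel-verified Lean document; each statement's English description precedes it below -/
import Mathlib

section
/- Let ν₀ be the probability measure on (1,∞) with density f(u) du = 2^{1/3} C u^{−2/3}(u² − 1)^{−1/3} du, where C = √3 Γ(2/3) Γ(5/6)/(2π^{3/2}). Then the pushforward of the product measure ν₀ ⊗ ν₀ ⊗ ν₀ on (1,∞)³ under the involution Ψ equals ν₀ ⊗ ν₀ ⊗ ν₀. Equivalently: if the exponentials a = e^{ℓ₁}, c = e^{ℓ₃}, b = e^{ℓ₅} of three alternate side lengths of a right-angled hexagon are chosen i.i.d. from ν₀, then the exponentials (A,B,C) of the other three side lengths are also i.i.d. with distribution ν₀. -/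
open MeasureTheory

/-- The ratio `R_A = (1+abc)(a+bc)/((b+ac)(c+ab))`. -/
noncomputable def ratioA (a b c : ℝ) : ℝ :=
  (1 + a*b*c) * (a + b*c) / ((b + a*c) * (c + a*b))

/-- The unique `A > 1` with `(A+1)/(A−1) = √R_A`, namely `A = (√R_A + 1)/(√R_A − 1)`. -/
noncomputable def hexA (a b c : ℝ) : ℝ :=
  (Real.sqrt (ratioA a b c) + 1) / (Real.sqrt (ratioA a b c) - 1)

/-- `Ψ` on ordered triples: `Ψ(a,b,c) = (A,B,C)`. -/
noncomputable def Psi (p : ℝ × ℝ × ℝ) : ℝ × ℝ × ℝ :=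
  (hexA p.1 p.2.1 p.2.2, hexA p.2.1 p.1 p.2.2, hexA p.2.2 p.1 p.2.1)

/-- The normalizing constant `C = √3 Γ(2/3) Γ(5/6) / (2 π^{3/2})`. -/
noncomputable def hexConst : ℝ :=
  Real.sqrt 3 * Real.Gamma (2/3) * Real.Gamma (5/6) / (2 * Real.pi ^ ((3:ℝ)/2))

/-- The density `f(u) = 2^{1/3} C u^{−2/3}(u²−1)^{−1/3}`. -/
noncomputable def fdens (u : ℝ) : ℝ :=
  (2:ℝ) ^ ((1:ℝ)/3) * hexConst * u ^ (-(2:ℝ)/3) * (u^2 - 1) ^ (-(1:ℝ)/3)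

/-- The probability measure `ν₀` on `(1,∞)` with density `f(u) du`. -/
noncomputable def nuZero : Measure ℝ :=
  (volume.restrict (Set.Ioi (1:ℝ))).withDensity (fun u => ENNReal.ofReal (fdens u))

/-- Abstract change of variables for measures with density on a set `S`. -/
lemma hex_map_withDensity {V : Type*} [NormedAddCommGroup V] [NormedSpace ℝ V]
    [FiniteDimensional ℝ V] [MeasurableSpace V] [BorelSpace V] (μ : Measure V)
    [μ.IsAddHaarMeasure] (S : Set V) (hS : MeasurableSet S) (f g : V → V) (f' : V → V →L[ℝ] V)
    (hg : Measurable g) (hfS : ∀ x ∈ S, f x ∈ S) (hgS : ∀ x ∈ S, g x ∈ S)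
    (hgf : ∀ x ∈ S, g (f x) = x) (hfg : ∀ x ∈ S, f (g x) = x)
    (hf' : ∀ x ∈ S, HasFDerivAt f (f' x) x) (w₁ w₂ : V → ENNReal)
    (hw : ∀ x ∈ S, ENNReal.ofReal |(f' x).det| * w₂ (f x) = w₁ x) :
    Measure.map g ((μ.restrict S).withDensity w₂) = (μ.restrict S).withDensity w₁ := by
  ext s hs
  rw [Measure.map_apply hg hs, withDensity_apply _ (hg hs), withDensity_apply _ hs,
    Measure.restrict_restrict (hg hs), Measure.restrict_restrict hs]
  have himg : g ⁻¹' s ∩ S = f '' (s ∩ S) := by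
    ext x
    constructor
    · rintro ⟨h1, h2⟩
      exact ⟨g x, ⟨h1, hgS x h2⟩, hfg x h2⟩
    · rintro ⟨y, ⟨h1, h2⟩, rfl⟩
      refine ⟨?_, hfS y h2⟩
      change g (f y) ∈ s
      rw [hgf y h2]; exact h1
  rw [himg, lintegral_image_eq_lintegral_abs_det_fderiv_mul μ (hs.inter hS)
    (fun x hx => (hf' x hx.2).hasFDerivWithinAt)]
  · exact setLIntegral_congr_fun (hs.inter hS) (fun x hx => hw x hx.2)
  · intro x hx y hy hxy
    rw [← hgf x hx.2, ← hgf y hy.2, hxy]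

/-- The inverse of `hexCh` on `(1,∞)`. -/
noncomputable def hexE (x : ℝ) : ℝ := x + Real.sqrt (x^2 - 1)

/-- `cosh` in the exponential coordinate. -/
noncomputable def hexCh (u : ℝ) : ℝ := (u + u⁻¹) / 2

lemma hexCh_sq {u : ℝ} (hu : 1 < u) : hexCh u ^ 2 - 1 = ((u - u⁻¹) / 2) ^ 2 := by
  unfold hexCh
  field_simp
  ring

lemma hexCh_sub_pos {u : ℝ} (hu : 1 < u) : 0 < (u - u⁻¹) / 2 := by
  have := inv_lt_one_of_one_lt₀ hu
  linarith

lemma hexCh_sqrt {u : ℝ} (hu : 1 < u) : Real.sqrt (hexCh u ^ 2 - 1) = (u - u⁻¹) / 2 := by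
  rw [hexCh_sq hu, Real.sqrt_sq (hexCh_sub_pos hu).le]

lemma hexCh_gt {u : ℝ} (hu : 1 < u) : 1 < hexCh u := by
  have h1 := hexCh_sq hu
  have h2 := pow_pos (hexCh_sub_pos hu) 2
  have h3 : 0 < hexCh u := by unfold hexCh; positivity
  nlinarith

lemma hexE_hexCh {u : ℝ} (hu : 1 < u) : hexE (hexCh u) = u := by
  unfold hexE
  rw [hexCh_sqrt hu]; unfold hexCh; ring

lemma hexE_gt {x : ℝ} (hx : 1 < x) : 1 < hexE x := by
  have := Real.sqrt_nonneg (x^2-1)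
  unfold hexE; linarith

lemma hexCh_hexE {x : ℝ} (hx : 1 < x) : hexCh (hexE x) = x := by
  have h0 : 0 < hexE x := by linarith [hexE_gt hx]
  have hs : Real.sqrt (x^2-1) ^ 2 = x^2 - 1 := Real.sq_sqrt (by nlinarith)
  have : (hexE x)⁻¹ = x - Real.sqrt (x^2-1) := by
    refine inv_eq_of_mul_eq_one_right ?_
    unfold hexE; nlinarith
  rw [hexCh, this, hexE]; ring

/-- The weight in the `cosh` coordinate. -/
noncomputable def hexW (x : ℝ) : ℝ := hexConst * (x^2 - 1) ^ (-(2:ℝ)/3)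

lemma hexConst_nonneg : 0 ≤ hexConst := by
  unfold hexConst
  have h1 := Real.Gamma_pos_of_pos (show (0:ℝ) < 2/3 by norm_num)
  have h2 := Real.Gamma_pos_of_pos (show (0:ℝ) < 5/6 by norm_num)
  have := Real.pi_pos
  positivity

lemma hexW_fdens {u : ℝ} (hu : 1 < u) :
    |(1 - (u^2)⁻¹) / 2| * hexW (hexCh u) = fdens u := by
  have hu0 : 0 < u := by linarith
  have ht : 0 < u^2 - 1 := by nlinarith
  have h1 : (1 - (u^2)⁻¹) / 2 = (u^2 - 1) * (u ^ 2)⁻¹ * 2⁻¹ := by field_simp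
  rw [h1, abs_of_pos (by positivity), hexW, fdens, hexCh_sq hu]
  have h2 : (u - u⁻¹) / 2 = (u^2 - 1) * u⁻¹ * 2⁻¹ := by field_simp
  rw [h2]
  set t := u^2 - 1
  have e1 : ((t * u⁻¹ * 2⁻¹)^2) ^ (-(2:ℝ)/3) = t ^ (-(4:ℝ)/3) * u ^ ((4:ℝ)/3) * 2 ^ ((4:ℝ)/3) := by
    rw [← Real.rpow_natCast, ← Real.rpow_mul (by positivity), Real.mul_rpow (by positivity) (by positivity),
      Real.mul_rpow (by positivity) (by positivity), Real.inv_rpow hu0.le, Real.inv_rpow (by norm_num),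
      ← Real.rpow_neg hu0.le, ← Real.rpow_neg (by norm_num)]
    norm_num
  have e2 : t ^ (-(1:ℝ)/3) = t * t ^ (-(4:ℝ)/3) := by
    nth_rewrite 2 [← Real.rpow_one t]
    rw [← Real.rpow_add ht]; norm_num
  have e3 : u ^ (-(2:ℝ)/3) = (u^2)⁻¹ * u ^ ((4:ℝ)/3) := by
    rw [← Real.rpow_natCast, ← Real.rpow_neg hu0.le, ← Real.rpow_add hu0]; norm_num
  have e4 : (2:ℝ) ^ ((1:ℝ)/3) = 2⁻¹ * 2 ^ ((4:ℝ)/3) := by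
    rw [← Real.rpow_neg_one, ← Real.rpow_add (by norm_num)]; norm_num
  rw [e1, e2, e3, e4]; ring

/-- The law in the `cosh` coordinate. -/
noncomputable def hexMu : Measure ℝ :=
  (volume.restrict (Set.Ioi (1:ℝ))).withDensity (fun u => ENNReal.ofReal (hexW u))

lemma hexE_measurable : Measurable hexE := by unfold hexE; fun_prop

lemma hexMu_map : Measure.map hexE hexMu = nuZero := by
  unfold hexMu nuZero
  refine hex_map_withDensity volume (Set.Ioi 1) measurableSet_Ioi hexCh hexE
    (fun u => ContinuousLinearMap.toSpanSingleton ℝ ((1 - (u^2)⁻¹)/2)) hexE_measurable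
    (fun x hx => hexCh_gt hx) (fun x hx => hexE_gt hx) (fun x hx => hexE_hexCh hx)
    (fun x hx => hexCh_hexE hx) ?_ _ _ ?_
  · intro x hx
    have hx : 1 < x := hx
    have := (((hasDerivAt_id x).add (hasDerivAt_inv (by linarith : x ≠ 0))).div_const 2)
    exact (this.hasFDerivAt).congr_fderiv (by ext; simp; ring)
  · intro x hx
    rw [ContinuousLinearMap.det_toSpanSingleton, ← ENNReal.ofReal_mul (abs_nonneg _), hexW_fdens hx]

/-- Law of cosines for right-angled hexagons. -/
noncomputable def hexF (x y z : ℝ) : ℝ :=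
  (x + y*z) / (Real.sqrt (y^2-1) * Real.sqrt (z^2-1))

noncomputable def hexPhi (p : ℝ × ℝ × ℝ) : ℝ × ℝ × ℝ :=
  (hexF p.1 p.2.1 p.2.2, hexF p.2.1 p.1 p.2.2, hexF p.2.2 p.1 p.2.1)

/-- The (negated) Gram determinant. -/
def hexD (x y z : ℝ) : ℝ := x^2 + y^2 + z^2 + 2*x*y*z - 1

lemma hexD_pos {x y z : ℝ} (hx : 1 < x) (hy : 1 < y) (hz : 1 < z) : 0 < hexD x y z := by
  unfold hexD
  have : 0 < x*y*z := by positivity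
  nlinarith

lemma hexF_sq {x y z : ℝ} (hy : 1 < y) (hz : 1 < z) :
    hexF x y z ^ 2 - 1 = hexD x y z / ((y^2-1)*(z^2-1)) := by
  have h1 : 0 < y^2-1 := by nlinarith
  have h2 : 0 < z^2-1 := by nlinarith
  unfold hexF hexD
  rw [div_pow, mul_pow, Real.sq_sqrt h1.le, Real.sq_sqrt h2.le]
  field_simp
  ring

lemma hexF_gt {x y z : ℝ} (hx : 1 < x) (hy : 1 < y) (hz : 1 < z) : 1 < hexF x y z := by
  have h1 : 0 < y^2-1 := by nlinarith
  have h2 : 0 < z^2-1 := by nlinarith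
  have h3 := hexD_pos hx hy hz
  have h4 : 0 < hexF x y z ^ 2 - 1 := by rw [hexF_sq hy hz]; positivity
  have h5 : 0 < hexF x y z := by unfold hexF; positivity
  nlinarith

lemma hexF_invol {x y z : ℝ} (hx : 1 < x) (hy : 1 < y) (hz : 1 < z) :
    hexF (hexF x y z) (hexF y x z) (hexF z x y) = x := by
  have h0 : 0 < x^2-1 := by nlinarith
  have h1 : 0 < y^2-1 := by nlinarith
  have h2 : 0 < z^2-1 := by nlinarith
  have hD := hexD_pos hx hy hz
  have eY : hexD y x z = hexD x y z := by unfold hexD; ring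
  have eZ : hexD z x y = hexD x y z := by unfold hexD; ring
  rw [hexF, hexF_sq hx hz, hexF_sq hx hy, eY, eZ, Real.sqrt_div hD.le, Real.sqrt_div hD.le,
    Real.sqrt_mul h0.le, Real.sqrt_mul h0.le]
  unfold hexF
  have s0 := Real.sq_sqrt h0.le
  have sD := Real.sq_sqrt hD.le
  have p0 := Real.sqrt_pos.2 h0
  have p1 := Real.sqrt_pos.2 h1
  have p2 := Real.sqrt_pos.2 h2
  have pD := Real.sqrt_pos.2 hD
  set a := Real.sqrt (x^2-1)
  set b := Real.sqrt (y^2-1)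
  set c := Real.sqrt (z^2-1)
  set d := Real.sqrt (hexD x y z)
  have key : (x + y*z) * a^2 + (y + x*z)*(z + x*y) = x * d^2 := by
    rw [s0, sD]; unfold hexD; ring
  rw [div_eq_iff (by positivity)]
  field_simp
  linear_combination key

lemma hexF_comm (x y z : ℝ) : hexF x y z = hexF x z y := by
  unfold hexF
  rw [mul_comm y z, mul_comm (Real.sqrt (y^2-1))]

lemma hexA_eq {a b c : ℝ} (ha : 1 < a) (hb : 1 < b) (hc : 1 < c) :
    hexA a b c = hexE (hexF (hexCh a) (hexCh b) (hexCh c)) := by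
  have a0 : 0 < a := by linarith
  have b0 : 0 < b := by linarith
  have c0 : 0 < c := by linarith
  have hb2 : 0 < b^2-1 := by nlinarith
  have hc2 : 0 < c^2-1 := by nlinarith
  set N := (1 + a*b*c) * (a + b*c) with hN
  set M := (b + a*c) * (c + a*b) with hM
  have hM0 : 0 < M := by positivity
  have hNM : N - M = a*(b^2-1)*(c^2-1) := by rw [hN, hM]; ring
  have hNM0 : 0 < N - M := by rw [hNM]; positivity
  have hr : 1 < ratioA a b c := by
    unfold ratioA
    rw [lt_div_iff₀ hM0]; linarith
  have hR : 1 < Real.sqrt (ratioA a b c) := by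
    rw [Real.lt_sqrt (by norm_num)]; simpa using hr
  have hRs : Real.sqrt (ratioA a b c) ^ 2 = N / M := Real.sq_sqrt (by linarith)
  unfold hexA
  set R := Real.sqrt (ratioA a b c)
  have hR1 : 0 < R - 1 := by linarith
  have hA : 1 < (R+1)/(R-1) := by rw [lt_div_iff₀ hR1]; linarith
  rw [← hexE_hexCh hA]
  congr 1
  have hR2 : R^2 - 1 = (N-M)/M := by rw [hRs]; field_simp
  have hR2' : 0 < R^2 - 1 := by rw [hR2]; positivity
  have h1 : hexCh ((R+1)/(R-1)) = (R^2+1)/(R^2-1) := by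
    unfold hexCh
    have : R + 1 ≠ 0 := by linarith
    rw [eq_div_iff hR2'.ne']
    field_simp
    ring
  rw [h1, hR2, hRs, hexF, hexCh_sqrt hb, hexCh_sqrt hc]
  have e1 : (b - b⁻¹)/2 = (b^2-1)/(2*b) := by field_simp
  have e2 : (c - c⁻¹)/2 = (c^2-1)/(2*c) := by field_simp
  have e3 : (N/M + 1) / ((N-M)/M) = (N+M)/(N-M) := by field_simp
  rw [e1, e2, e3, hNM, hN, hM]
  unfold hexCh
  field_simp
  ring

lemma hexF_hasFDerivAt {V : Type*} [NormedAddCommGroup V] [NormedSpace ℝ V] {u v w : V → ℝ}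
    {u' v' w' : V →L[ℝ] ℝ} {p : V} (hu : HasFDerivAt u u' p) (hv : HasFDerivAt v v' p)
    (hw : HasFDerivAt w w' p) (hv1 : 1 < v p) (hw1 : 1 < w p) :
    HasFDerivAt (fun q => hexF (u q) (v q) (w q))
      ((1 / (Real.sqrt (v p^2-1) * Real.sqrt (w p^2-1))) •
        (u' + (-(w p + u p * v p) / (v p^2-1)) • v' + (-(v p + u p * w p) / (w p^2-1)) • w')) p := by
  have h1 : 0 < v p^2-1 := by nlinarith
  have h2 : 0 < w p^2-1 := by nlinarith
  have p1 := Real.sqrt_pos.2 h1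
  have p2 := Real.sqrt_pos.2 h2
  have s1 := Real.sq_sqrt h1.le
  have s2 := Real.sq_sqrt h2.le
  have hden := (((hv.pow 2).sub_const 1).sqrt h1.ne').mul (((hw.pow 2).sub_const 1).sqrt h2.ne')
  have hnum := hu.add (hv.mul hw)
  have := hnum.mul ((hasDerivAt_inv (mul_pos p1 p2).ne').comp_hasFDerivAt p hden)
  refine (this.congr_fderiv ?_).congr_of_eventuallyEq
    (Filter.Eventually.of_forall fun q => by simp [hexF, div_eq_mul_inv])
  ext q
  simp only [Pi.mul_apply, Pi.add_apply, Function.comp, add_apply,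
    smul_apply, smul_eq_mul, nsmul_eq_mul]
  set b := Real.sqrt (v p^2-1)
  set c := Real.sqrt (w p^2-1)
  rw [← s1, ← s2]
  have t1 : v p ^2 = b^2 + 1 := by rw [s1]; ring
  have t2 : w p ^2 = c^2 + 1 := by rw [s2]; ring
  push_cast
  field_simp
  linear_combination (-(c^2 * w p * v' q)) * t1 - (b^2 * v p * w' q) * t2

def hexEquiv : (ℝ × ℝ × ℝ) ≃ₗ[ℝ] (Fin 3 → ℝ) where
  toFun p := ![p.1, p.2.1, p.2.2]
  invFun v := (v 0, v 1, v 2)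
  map_add' p q := by ext i; fin_cases i <;> simp
  map_smul' r p := by ext i; fin_cases i <;> simp
  left_inv p := by simp
  right_inv v := by ext i; fin_cases i <;> simp

lemma hex_det (L : (ℝ × ℝ × ℝ) →L[ℝ] (ℝ × ℝ × ℝ)) :
    L.det = (L (1,0,0)).1 * (L (0,1,0)).2.1 * (L (0,0,1)).2.2
      - (L (1,0,0)).1 * (L (0,0,1)).2.1 * (L (0,1,0)).2.2
      - (L (0,1,0)).1 * (L (1,0,0)).2.1 * (L (0,0,1)).2.2
      + (L (0,1,0)).1 * (L (0,0,1)).2.1 * (L (1,0,0)).2.2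
      + (L (0,0,1)).1 * (L (1,0,0)).2.1 * (L (0,1,0)).2.2
      - (L (0,0,1)).1 * (L (0,1,0)).2.1 * (L (1,0,0)).2.2 := by
  have h := LinearMap.det_toMatrix (Module.Basis.ofEquivFun hexEquiv) (L : (ℝ × ℝ × ℝ) →ₗ[ℝ] (ℝ × ℝ × ℝ))
  rw [ContinuousLinearMap.det, ← h, Matrix.det_fin_three]
  simp [LinearMap.toMatrix_apply, hexEquiv]

/-- The derivative of `hexPhi`. -/
noncomputable def hexPhi' (p : ℝ × ℝ × ℝ) : (ℝ × ℝ × ℝ) →L[ℝ] (ℝ × ℝ × ℝ) :=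
  let X := ContinuousLinearMap.fst ℝ ℝ (ℝ × ℝ)
  let Y := (ContinuousLinearMap.fst ℝ ℝ ℝ).comp (ContinuousLinearMap.snd ℝ ℝ (ℝ × ℝ))
  let Z := (ContinuousLinearMap.snd ℝ ℝ ℝ).comp (ContinuousLinearMap.snd ℝ ℝ (ℝ × ℝ))
  let x := p.1
  let y := p.2.1
  let z := p.2.2
  ((1 / (Real.sqrt (y^2-1) * Real.sqrt (z^2-1))) •
    (X + (-(z + x * y) / (y^2-1)) • Y + (-(y + x * z) / (z^2-1)) • Z)).prod
  (((1 / (Real.sqrt (x^2-1) * Real.sqrt (z^2-1))) •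
    (Y + (-(z + y * x) / (x^2-1)) • X + (-(x + y * z) / (z^2-1)) • Z)).prod
  ((1 / (Real.sqrt (x^2-1) * Real.sqrt (y^2-1))) •
    (Z + (-(y + z * x) / (x^2-1)) • X + (-(x + z * y) / (y^2-1)) • Y)))

/-- The domain `(1,∞)³`. -/
def hexS : Set (ℝ × ℝ × ℝ) := Set.Ioi 1 ×ˢ (Set.Ioi 1 ×ˢ Set.Ioi 1)

lemma hexPhi_hasFDerivAt (p : ℝ × ℝ × ℝ) (hp : p ∈ hexS) : HasFDerivAt hexPhi (hexPhi' p) p := by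
  obtain ⟨hx, hy, hz⟩ := hp
  have hX : HasFDerivAt (fun q : ℝ × ℝ × ℝ => q.1) (ContinuousLinearMap.fst ℝ ℝ (ℝ × ℝ)) p :=
    hasFDerivAt_fst
  have hYZ : HasFDerivAt (fun q : ℝ × ℝ × ℝ => q.2) (ContinuousLinearMap.snd ℝ ℝ (ℝ × ℝ)) p :=
    hasFDerivAt_snd
  have hY := hYZ.fst
  have hZ := hYZ.snd
  exact (hexF_hasFDerivAt hX hY hZ hy hz).prodMk
    ((hexF_hasFDerivAt hY hX hZ hx hz).prodMk (hexF_hasFDerivAt hZ hX hY hx hy))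

lemma hexPhi'_det (x y z : ℝ) (hx : 1 < x) (hy : 1 < y) (hz : 1 < z) :
    (hexPhi' (x,y,z)).det = - (hexD x y z ^ 2 / ((x^2-1)*(y^2-1)*(z^2-1))^2) := by
  have h0 : 0 < x^2-1 := by nlinarith
  have h1 : 0 < y^2-1 := by nlinarith
  have h2 : 0 < z^2-1 := by nlinarith
  have s0 := Real.sq_sqrt h0.le
  have s1 := Real.sq_sqrt h1.le
  have s2 := Real.sq_sqrt h2.le
  have p0 := Real.sqrt_pos.2 h0
  have p1 := Real.sqrt_pos.2 h1
  have p2 := Real.sqrt_pos.2 h2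
  rw [hex_det]
  simp only [hexPhi', ContinuousLinearMap.prod_apply, smul_apply,
    add_apply, ContinuousLinearMap.comp_apply, ContinuousLinearMap.coe_fst',
    ContinuousLinearMap.coe_snd', smul_eq_mul, mul_zero, mul_one, add_zero, zero_add]
  have e : (1 / (√(y^2-1) * √(z^2-1))) * (1 / (√(x^2-1) * √(z^2-1))) * (1 / (√(x^2-1) * √(y^2-1)))
      = 1 / ((x^2-1)*(y^2-1)*(z^2-1)) := by
    rw [← s0, ← s1, ← s2, Real.sqrt_sq p0.le, Real.sqrt_sq p1.le, Real.sqrt_sq p2.le]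
    field_simp
  generalize 1 / (√(y^2-1) * √(z^2-1)) = k1 at *
  generalize 1 / (√(x^2-1) * √(z^2-1)) = k2 at *
  generalize 1 / (√(x^2-1) * √(y^2-1)) = k3 at *
  have key : 1 - 2 * ((x+y*z)*(y+x*z)*(z+x*y)) / ((x^2-1)*(y^2-1)*(z^2-1))
      - (z+x*y)^2/((x^2-1)*(y^2-1)) - (y+x*z)^2/((x^2-1)*(z^2-1)) - (x+y*z)^2/((y^2-1)*(z^2-1))
      = - (hexD x y z^2 / ((x^2-1)*(y^2-1)*(z^2-1))) := by
    unfold hexD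
    field_simp
    ring
  have e2 : - (hexD x y z ^ 2 / ((x^2-1)*(y^2-1)*(z^2-1))^2) =
      (k1*k2*k3) * - (hexD x y z^2 / ((x^2-1)*(y^2-1)*(z^2-1))) := by
    rw [e]; field_simp
  rw [e2, ← key]
  field_simp
  ring

/-- The weight in three variables. -/
noncomputable def hexW3 (p : ℝ × ℝ × ℝ) : ENNReal :=
  ENNReal.ofReal (hexW p.1) * (ENNReal.ofReal (hexW p.2.1) * ENNReal.ofReal (hexW p.2.2))

lemma hexW_measurable : Measurable hexW := by unfold hexW; fun_prop

lemma hexW_nonneg {x : ℝ} (hx : 1 < x) : 0 ≤ hexW x := by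
  have : 0 < x^2-1 := by nlinarith
  have := hexConst_nonneg
  unfold hexW; positivity

lemma hexMu_prod : hexMu.prod (hexMu.prod hexMu) = (volume.restrict hexS).withDensity hexW3 := by
  have hm : Measurable (fun u => ENNReal.ofReal (hexW u)) := hexW_measurable.ennreal_ofReal
  have hW := hexW_measurable
  unfold hexMu
  rw [prod_withDensity hm hm, prod_withDensity hm (by fun_prop), Measure.prod_restrict,
    Measure.prod_restrict]
  rfl

lemma hexW3_eq (p : ℝ × ℝ × ℝ) (hp : p ∈ hexS) :
    ENNReal.ofReal |(hexPhi' p).det| * hexW3 (hexPhi p) = hexW3 p := by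
  obtain ⟨x, y, z⟩ := p
  obtain ⟨hx, hy, hz⟩ := hp
  change 1 < x at hx
  change 1 < y at hy
  change 1 < z at hz
  have h0 : 0 < x^2-1 := by nlinarith
  have h1 : 0 < y^2-1 := by nlinarith
  have h2 : 0 < z^2-1 := by nlinarith
  have hD := hexD_pos hx hy hz
  unfold hexW3 hexPhi
  simp only
  have n1 := hexW_nonneg hx
  have n2 := hexW_nonneg hy
  have n3 := hexW_nonneg hz
  have m1 := hexW_nonneg (hexF_gt hx hy hz)
  have m2 := hexW_nonneg (hexF_gt hy hx hz)
  have m3 := hexW_nonneg (hexF_gt hz hx hy)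
  rw [← ENNReal.ofReal_mul n2, ← ENNReal.ofReal_mul n1, ← ENNReal.ofReal_mul m2,
    ← ENNReal.ofReal_mul m1, ← ENNReal.ofReal_mul (abs_nonneg _), hexPhi'_det x y z hx hy hz]
  congr 1
  unfold hexW
  rw [hexF_sq hy hz, hexF_sq hx hz, hexF_sq hx hy]
  have eY : hexD y x z = hexD x y z := by unfold hexD; ring
  have eZ : hexD z x y = hexD x y z := by unfold hexD; ring
  rw [eY, eZ, abs_neg, abs_of_nonneg (by positivity)]
  generalize hexD x y z = D at *
  generalize x^2-1 = a at *
  generalize y^2-1 = b at *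
  generalize z^2-1 = c at *
  have e1 : (D/(b*c)) ^ (-(2:ℝ)/3) * ((D/(a*c)) ^ (-(2:ℝ)/3) * (D/(a*b)) ^ (-(2:ℝ)/3))
      = D ^ (-2 : ℝ) * ((a*b*c) ^ (2:ℝ) * (a ^ (-(2:ℝ)/3) * (b ^ (-(2:ℝ)/3) * c ^ (-(2:ℝ)/3)))) := by
    rw [← Real.mul_rpow (by positivity) (by positivity), ← Real.mul_rpow (by positivity) (by positivity),
      ← Real.mul_rpow (by positivity) (by positivity), ← Real.mul_rpow (by positivity) (by positivity)]
    have e0 : D/(b*c) * (D/(a*c) * (D/(a*b))) = D ^ (3:ℝ) * ((a*b*c)^ (-3:ℝ) * (a*(b*c))) := by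
      rw [Real.rpow_neg (by positivity)]
      norm_cast
      field_simp
    rw [e0, Real.mul_rpow (by positivity) (by positivity), Real.mul_rpow (by positivity) (by positivity),
      ← Real.rpow_mul hD.le, ← Real.rpow_mul (by positivity)]
    norm_num
  have e2 : D ^ (-2:ℝ) = (D^2)⁻¹ := by rw [Real.rpow_neg hD.le]; norm_cast
  have e3 : (a*b*c) ^ (2:ℝ) = (a*b*c)^2 := by norm_cast
  rw [e2, e3] at e1
  calc _ = hexConst^3 * (D ^ 2 / (a*b*c)^2 * ((D/(b*c)) ^ (-(2:ℝ)/3) *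
        ((D/(a*c)) ^ (-(2:ℝ)/3) * (D/(a*b)) ^ (-(2:ℝ)/3)))) := by ring
    _ = hexConst^3 * (a ^ (-(2:ℝ)/3) * (b ^ (-(2:ℝ)/3) * c ^ (-(2:ℝ)/3))) := by
        rw [e1]
        congr 1
        generalize a ^ (-(2:ℝ)/3) * (b ^ (-(2:ℝ)/3) * c ^ (-(2:ℝ)/3)) = t
        field_simp
    _ = _ := by ring

lemma hexPhi_measurable : Measurable hexPhi := by unfold hexPhi hexF; fun_prop

lemma hexPsi_measurable : Measurable Psi := by unfold Psi hexA ratioA; fun_prop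

lemma hexS_measurable : MeasurableSet hexS :=
  measurableSet_Ioi.prod (measurableSet_Ioi.prod measurableSet_Ioi)

lemma hexPhi_mem (p : ℝ × ℝ × ℝ) (hp : p ∈ hexS) : hexPhi p ∈ hexS := by
  obtain ⟨hx, hy, hz⟩ := hp
  exact ⟨hexF_gt hx hy hz, hexF_gt hy hx hz, hexF_gt hz hx hy⟩

lemma hexPhi_invol (p : ℝ × ℝ × ℝ) (hp : p ∈ hexS) : hexPhi (hexPhi p) = p := by
  obtain ⟨x, y, z⟩ := p
  obtain ⟨hx, hy, hz⟩ := hp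
  refine Prod.ext (hexF_invol hx hy hz) (Prod.ext ?_ ?_)
  · change hexF (hexF y x z) (hexF x y z) (hexF z x y) = y
    have := hexF_invol hy hx hz
    rwa [hexF_comm z y x] at this
  · change hexF (hexF z x y) (hexF x y z) (hexF y x z) = z
    have := hexF_invol hz hx hy
    rwa [hexF_comm x z y, hexF_comm y z x] at this

lemma hexPhi_map : Measure.map hexPhi (hexMu.prod (hexMu.prod hexMu)) =
    hexMu.prod (hexMu.prod hexMu) := by
  rw [hexMu_prod]
  have i2 : (volume : Measure (ℝ × ℝ)).IsAddHaarMeasure :=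
    inferInstanceAs ((volume : Measure ℝ).prod (volume : Measure ℝ)).IsAddHaarMeasure
  have i3 : (volume : Measure (ℝ × ℝ × ℝ)).IsAddHaarMeasure :=
    inferInstanceAs ((volume : Measure ℝ).prod (volume : Measure (ℝ × ℝ))).IsAddHaarMeasure
  exact hex_map_withDensity volume hexS hexS_measurable hexPhi hexPhi hexPhi' hexPhi_measurable
    hexPhi_mem hexPhi_mem hexPhi_invol hexPhi_invol hexPhi_hasFDerivAt _ _ hexW3_eq

lemma hexPsi_conj (p : ℝ × ℝ × ℝ) (hp : p ∈ hexS) :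
    Psi (Prod.map hexE (Prod.map hexE hexE) p) = Prod.map hexE (Prod.map hexE hexE) (hexPhi p) := by
  obtain ⟨x, y, z⟩ := p
  obtain ⟨hx, hy, hz⟩ := hp
  change 1 < x at hx
  change 1 < y at hy
  change 1 < z at hz
  have gx := hexE_gt hx
  have gy := hexE_gt hy
  have gz := hexE_gt hz
  simp only [Psi, Prod.map, hexPhi]
  rw [hexA_eq gx gy gz, hexA_eq gy gx gz, hexA_eq gz gx gy, hexCh_hexE hx, hexCh_hexE hy,
    hexCh_hexE hz]

/-- the pushforward of `ν₀ ⊗ ν₀ ⊗ ν₀` under the involution `Ψ` equals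
`ν₀ ⊗ ν₀ ⊗ ν₀`: if three alternate side-length exponentials of a right-angled hexagon
are i.i.d. with law `ν₀`, so are the other three. -/
theorem stmt7 :
    Measure.map Psi (nuZero.prod (nuZero.prod nuZero)) =
      nuZero.prod (nuZero.prod nuZero) := by
  have : SFinite hexMu := by unfold hexMu; infer_instance
  have hE := hexE_measurable
  have hE2 : Measurable (Prod.map hexE hexE) := hE.prodMap hE
  have hE3 : Measurable (Prod.map hexE (Prod.map hexE hexE)) := hE.prodMap hE2
  have hprod : nuZero.prod (nuZero.prod nuZero) =
      Measure.map (Prod.map hexE (Prod.map hexE hexE)) (hexMu.prod (hexMu.prod hexMu)) := by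
    rw [← hexMu_map, Measure.map_prod_map _ _ hE hE, Measure.map_prod_map _ _ hE hE2]
  rw [hprod, Measure.map_map hexPsi_measurable hE3]
  have hae : (Psi ∘ Prod.map hexE (Prod.map hexE hexE)) =ᵐ[hexMu.prod (hexMu.prod hexMu)]
      (Prod.map hexE (Prod.map hexE hexE) ∘ hexPhi) := by
    rw [hexMu_prod]
    refine (withDensity_absolutelyContinuous _ _).ae_le ?_
    filter_upwards [ae_restrict_mem hexS_measurable] with p hp
    exact hexPsi_conj p hp
  rw [Measure.map_congr hae, ← Measure.map_map hE3 hexPhi_measurable, hexPhi_map]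
end

section
/- For all a, b, c > 1, the absolute value of the Jacobian determinant of the map Ψ at (a,b,c) equals f(a)f(b)f(c) / (f(A)f(B)f(C)), where (A,B,C) = Ψ(a,b,c) and f(u) = 2^{1/3} C u^{−2/3}(u² − 1)^{−1/3} with C = √3 Γ(2/3) Γ(5/6)/(2π^{3/2}). Equivalently, f(a)f(b)f(c) da db dc = f(A)f(B)f(C) dA dB dC. -/
lemma ratioA_sub_one (a b c : ℝ) (ha : 1 < a) (hb : 1 < b) (hc : 1 < c) :
    ratioA a b c - 1 = a * (b^2-1) * (c^2-1) / ((b + a*c) * (c + a*b)) := by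
  have : 0 < b + a*c := by positivity
  have : 0 < c + a*b := by positivity
  unfold ratioA
  field_simp
  ring

lemma one_lt_ratioA (a b c : ℝ) (ha : 1 < a) (hb : 1 < b) (hc : 1 < c) :
    1 < ratioA a b c := by
  have h := ratioA_sub_one a b c ha hb hc
  have h1 : 0 < b^2-1 := by nlinarith
  have h2 : 0 < c^2-1 := by nlinarith
  have : 0 < a * (b^2-1) * (c^2-1) / ((b + a*c) * (c + a*b)) := by positivity
  linarith

lemma one_lt_sqrt_ratioA (a b c : ℝ) (ha : 1 < a) (hb : 1 < b) (hc : 1 < c) :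
    1 < √(ratioA a b c) := by
  rw [Real.lt_sqrt (by norm_num)]
  simpa using one_lt_ratioA a b c ha hb hc

lemma one_lt_hexA (a b c : ℝ) (ha : 1 < a) (hb : 1 < b) (hc : 1 < c) :
    1 < hexA a b c := by
  have h := one_lt_sqrt_ratioA a b c ha hb hc
  unfold hexA
  rw [lt_div_iff₀ (by linarith)]
  linarith

lemma hexA_sq (a b c : ℝ) (ha : 1 < a) (hb : 1 < b) (hc : 1 < c) :
    (hexA a b c)^2 = ((hexA a b c)^2-1)^2 * ((a * (b^2-1) * (c^2-1))^2 /
      (16 * ((1+a*b*c)*(a+b*c)*(b + a*c) * (c + a*b)))) := by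
  have h := one_lt_sqrt_ratioA a b c ha hb hc
  have hR := one_lt_ratioA a b c ha hb hc
  have e : (a * (b^2-1) * (c^2-1))^2 / (16 * ((1+a*b*c)*(a+b*c)*(b + a*c) * (c + a*b)))
      = (ratioA a b c - 1)^2 / (16 * ratioA a b c) := by
    rw [ratioA_sub_one a b c ha hb hc]
    have : 0 < b + a*c := by positivity
    have : 0 < c + a*b := by positivity
    have : 0 < a + b*c := by positivity
    have : 0 < 1 + a*b*c := by positivity
    unfold ratioA
    field_simp
  rw [e]
  unfold hexA
  have hs : ratioA a b c = (√(ratioA a b c))^2 := (Real.sq_sqrt (by linarith)).symm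
  set r := √(ratioA a b c)
  rw [hs]
  have h1 : r - 1 ≠ 0 := by linarith
  have h2 : r ≠ 0 := by linarith
  field_simp
  ring

/-- Linear form with given coefficients. -/
noncomputable def lin3 (x y z : ℝ) : ℝ × ℝ × ℝ →L[ℝ] ℝ :=
  x • ContinuousLinearMap.fst ℝ ℝ (ℝ × ℝ)
  + y • (ContinuousLinearMap.fst ℝ ℝ ℝ).comp (ContinuousLinearMap.snd ℝ ℝ (ℝ × ℝ))
  + z • (ContinuousLinearMap.snd ℝ ℝ ℝ).comp (ContinuousLinearMap.snd ℝ ℝ (ℝ × ℝ))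

lemma lin3_apply (x y z : ℝ) (p : ℝ × ℝ × ℝ) :
    lin3 x y z p = x * p.1 + y * p.2.1 + z * p.2.2 := by
  simp [lin3]

lemma hasFDerivAt_ratioA (a b c : ℝ) (ha : 1 < a) (hb : 1 < b) (hc : 1 < c) :
    HasFDerivAt (fun p : ℝ × ℝ × ℝ => ratioA p.1 p.2.1 p.2.2)
      (ratioA a b c • lin3 (b*c/(1+a*b*c) + 1/(a+b*c) - c/(b+a*c) - b/(c+a*b))
        (a*c/(1+a*b*c) + c/(a+b*c) - 1/(b+a*c) - a/(c+a*b))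
        (a*b/(1+a*b*c) + b/(a+b*c) - a/(b+a*c) - 1/(c+a*b))) (a,b,c) := by
  have hx : HasFDerivAt (fun p : ℝ × ℝ × ℝ => p.1) (lin3 1 0 0) (a,b,c) := by
    convert (lin3 1 0 0).hasFDerivAt using 1
    ext p; simp [lin3_apply]
  have hy : HasFDerivAt (fun p : ℝ × ℝ × ℝ => p.2.1) (lin3 0 1 0) (a,b,c) := by
    convert (lin3 0 1 0).hasFDerivAt using 1
    ext p; simp [lin3_apply]
  have hz : HasFDerivAt (fun p : ℝ × ℝ × ℝ => p.2.2) (lin3 0 0 1) (a,b,c) := by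
    convert (lin3 0 0 1).hasFDerivAt using 1
    ext p; simp [lin3_apply]
  have hQ : 0 < b + a*c := by positivity
  have hS : 0 < c + a*b := by positivity
  have hP : 0 < a + b*c := by positivity
  have hN : 0 < 1 + a*b*c := by positivity
  have hnum := (((hx.mul hy).mul hz).const_add 1).mul (hx.add (hy.mul hz))
  have hden := (hy.add (hx.mul hz)).mul (hz.add (hx.mul hy))
  have hden0 : (b + a*c) * (c + a*b) ≠ 0 := by positivity
  have hinv := (hasDerivAt_inv hden0).comp_hasFDerivAt (a,b,c) hden
  have := hnum.mul hinv
  refine (this.congr_fderiv ?_).congr_of_eventuallyEq (Filter.Eventually.of_forall ?_)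
  · apply ContinuousLinearMap.ext
    rintro ⟨u, v, w⟩
    simp [lin3_apply, ratioA]
    field_simp
    ring
  · intro p
    simp [ratioA, div_eq_mul_inv]

lemma hasFDerivAt_hexA (a b c : ℝ) (ha : 1 < a) (hb : 1 < b) (hc : 1 < c) :
    HasFDerivAt (fun p : ℝ × ℝ × ℝ => hexA p.1 p.2.1 p.2.2)
      ((-((hexA a b c)^2-1)/4) • lin3 (b*c/(1+a*b*c) + 1/(a+b*c) - c/(b+a*c) - b/(c+a*b))
        (a*c/(1+a*b*c) + c/(a+b*c) - 1/(b+a*c) - a/(c+a*b))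
        (a*b/(1+a*b*c) + b/(a+b*c) - a/(b+a*c) - 1/(c+a*b))) (a,b,c) := by
  have h := one_lt_sqrt_ratioA a b c ha hb hc
  have hR := one_lt_ratioA a b c ha hb hc
  have h1 := hasFDerivAt_ratioA a b c ha hb hc
  have hs := Real.hasDerivAt_sqrt (x := ratioA a b c) (by linarith)
  have hg := (hs.add_const 1).div (hs.sub_const 1) (by linarith)
  have := hg.comp_hasFDerivAt (a,b,c) h1
  refine (this.congr_fderiv ?_).congr_of_eventuallyEq (Filter.Eventually.of_forall ?_)
  · rw [smul_smul]
    congr 1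
    unfold hexA
    have hs : ratioA a b c = (√(ratioA a b c))^2 := (Real.sq_sqrt (by linarith)).symm
    set r := √(ratioA a b c)
    rw [hs]
    have h1 : r - 1 ≠ 0 := by linarith
    have h2 : r ≠ 0 := by linarith
    field_simp
    ring
  · intro p
    simp [hexA]

lemma det_lin3 (M : Matrix (Fin 3) (Fin 3) ℝ) :
    ((lin3 (M 0 0) (M 0 1) (M 0 2)).prod ((lin3 (M 1 0) (M 1 1) (M 1 2)).prod
      (lin3 (M 2 0) (M 2 1) (M 2 2)))).det = M.det := by
  let e : (Fin 3 → ℝ) ≃ₗ[ℝ] ℝ × ℝ × ℝ :=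
    { toFun := fun v => (v 0, v 1, v 2)
      invFun := fun p => ![p.1, p.2.1, p.2.2]
      map_add' := fun _ _ => rfl
      map_smul' := fun _ _ => rfl
      left_inv := fun v => by ext i; fin_cases i <;> rfl
      right_inv := fun p => rfl }
  rw [← LinearMap.det_toLin' M, ← LinearMap.det_conj (Matrix.toLin' M) e]
  unfold ContinuousLinearMap.det
  congr 1
  apply LinearMap.ext
  rintro ⟨u, v, w⟩
  simp [e, lin3_apply, Matrix.mulVec, dotProduct, Fin.sum_univ_three]
  exact ⟨rfl, rfl, rfl⟩

lemma hexConst_pos : 0 < hexConst := by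
  unfold hexConst
  have := Real.Gamma_pos_of_pos (show (0:ℝ) < 2/3 by norm_num)
  have := Real.Gamma_pos_of_pos (show (0:ℝ) < 5/6 by norm_num)
  positivity

lemma fdens_pos (u : ℝ) (hu : 1 < u) : 0 < fdens u := by
  have : 0 < u^2-1 := by nlinarith
  have := hexConst_pos
  unfold fdens
  positivity

lemma fdens_cube (u : ℝ) (hu : 1 < u) :
    fdens u ^ 3 = 2 * hexConst^3 / (u^2 * (u^2-1)) := by
  have h : 0 < u^2-1 := by nlinarith
  have h0 : 0 < u := by linarith
  unfold fdens
  rw [mul_pow, mul_pow, mul_pow, ← Real.rpow_natCast (2 ^ _), ← Real.rpow_natCast (u ^ _),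
    ← Real.rpow_natCast ((u^2-1) ^ _), ← Real.rpow_mul (by norm_num), ← Real.rpow_mul h0.le,
    ← Real.rpow_mul h.le]
  have e1 : (1:ℝ)/3 * (3:ℕ) = 1 := by norm_num
  have e2 : (-(2:ℝ)/3) * (3:ℕ) = -(2:ℕ) := by norm_num
  have e3 : (-(1:ℝ)/3) * (3:ℕ) = -1 := by norm_num
  rw [e1, e2, e3, Real.rpow_neg h0.le, Real.rpow_natCast, Real.rpow_neg_one, Real.rpow_one]
  field_simp

lemma det_Psi (a b c : ℝ) (ha : 1 < a) (hb : 1 < b) (hc : 1 < c) :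
    |(fderiv ℝ Psi (a, b, c)).det| =
      ((hexA a b c)^2-1) * ((hexA b a c)^2-1) * ((hexA c a b)^2-1) / 16 *
      ((a^2-1)*(b^2-1)*(c^2-1) / ((1+a*b*c)*(a+b*c)*(b+a*c)*(c+a*b))) := by
  have hA := hasFDerivAt_hexA a b c ha hb hc
  have hs1 : ((lin3 0 1 0).prod ((lin3 1 0 0).prod (lin3 0 0 1))) (a,b,c) = (b,a,c) := by
    simp [lin3_apply]
  have hs2 : ((lin3 0 0 1).prod ((lin3 1 0 0).prod (lin3 0 1 0))) (a,b,c) = (c,a,b) := by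
    simp [lin3_apply]
  have hB0 := hasFDerivAt_hexA b a c hb ha hc
  rw [← hs1] at hB0
  have hB := hB0.comp (a,b,c)
    ((lin3 0 1 0).prod ((lin3 1 0 0).prod (lin3 0 0 1))).hasFDerivAt
  have hC0 := hasFDerivAt_hexA c a b hc ha hb
  rw [← hs2] at hC0
  have hC := hC0.comp (a,b,c)
    ((lin3 0 0 1).prod ((lin3 1 0 0).prod (lin3 0 1 0))).hasFDerivAt
  have hPsi := hA.prodMk (hB.prodMk hC)
  set KA := (hexA a b c)^2-1 with hKA
  set KB := (hexA b a c)^2-1 with hKB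
  set KC := (hexA c a b)^2-1 with hKC
  let M : Matrix (Fin 3) (Fin 3) ℝ :=
    !![-KA/4 * (b*c/(1+a*b*c) + 1/(a+b*c) - c/(b+a*c) - b/(c+a*b)),
       -KA/4 * (a*c/(1+a*b*c) + c/(a+b*c) - 1/(b+a*c) - a/(c+a*b)),
       -KA/4 * (a*b/(1+a*b*c) + b/(a+b*c) - a/(b+a*c) - 1/(c+a*b));
       -KB/4 * (b*c/(1+a*b*c) - 1/(a+b*c) + c/(b+a*c) - b/(c+a*b)),
       -KB/4 * (a*c/(1+a*b*c) - c/(a+b*c) + 1/(b+a*c) - a/(c+a*b)),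
       -KB/4 * (a*b/(1+a*b*c) - b/(a+b*c) + a/(b+a*c) - 1/(c+a*b));
       -KC/4 * (b*c/(1+a*b*c) - 1/(a+b*c) - c/(b+a*c) + b/(c+a*b)),
       -KC/4 * (a*c/(1+a*b*c) - c/(a+b*c) - 1/(b+a*c) + a/(c+a*b)),
       -KC/4 * (a*b/(1+a*b*c) - b/(a+b*c) - a/(b+a*c) + 1/(c+a*b))]
  have hPsi2 : HasFDerivAt Psi ((lin3 (M 0 0) (M 0 1) (M 0 2)).prod
      ((lin3 (M 1 0) (M 1 1) (M 1 2)).prod (lin3 (M 2 0) (M 2 1) (M 2 2)))) (a,b,c) := by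
    refine (hPsi.congr_fderiv ?_).congr_of_eventuallyEq (Filter.Eventually.of_forall ?_)
    · apply ContinuousLinearMap.ext
      rintro ⟨u, v, w⟩
      have n3 : b*a = a*b := by ring
      have n4 : c*a = a*c := by ring
      have n5 : c*b = b*c := by ring
      simp only [ContinuousLinearMap.prod_apply, ContinuousLinearMap.comp_apply,
        _root_.smul_apply, lin3_apply, smul_eq_mul, M, n3, n4, n5,
        Matrix.of_apply, Matrix.cons_val]
      refine Prod.ext ?_ (Prod.ext ?_ ?_)
      · ring
      · dsimp only
        ring
      · dsimp only
        rw [show a*c*b = a*b*c by ring]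
        ring
    · intro p
      simp [Psi, lin3_apply]
  rw [hPsi2.fderiv, det_lin3]
  have a1 : 0 < a^2-1 := by nlinarith
  have b1 : 0 < b^2-1 := by nlinarith
  have c1 : 0 < c^2-1 := by nlinarith
  have kA : 0 < KA := by have := one_lt_hexA a b c ha hb hc; rw [hKA]; nlinarith
  have kB : 0 < KB := by have := one_lt_hexA b a c hb ha hc; rw [hKB]; nlinarith
  have kC : 0 < KC := by have := one_lt_hexA c a b hc ha hb; rw [hKC]; nlinarith
  have hQ : 0 < b + a*c := by positivity
  have hS : 0 < c + a*b := by positivity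
  have hP : 0 < a + b*c := by positivity
  have hN : 0 < 1 + a*b*c := by positivity
  have hdet : M.det = -(KA * KB * KC / 16 *
      ((a^2-1)*(b^2-1)*(c^2-1) / ((1+a*b*c)*(a+b*c)*(b+a*c)*(c+a*b)))) := by
    rw [Matrix.det_fin_three]
    simp only [M, Matrix.of_apply, Matrix.cons_val]
    clear_value KA KB KC
    field_simp
    ring
  rw [hdet, abs_neg, abs_of_pos]
  positivity

lemma sq_sub_one_pos {u : ℝ} (hu : 1 < u) : 0 < u^2-1 := by nlinarith

lemma final_algebra {a b c KA KB KC x y z k N P Q S A2 B2 C2 : ℝ}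
    (ha : 0 < a) (hb : 0 < b) (hc : 0 < c) (kA : 0 < KA) (kB : 0 < KB) (kC : 0 < KC)
    (hx : 0 < x) (hy : 0 < y) (hz : 0 < z) (hk : 0 < k)
    (hN : 0 < N) (hP : 0 < P) (hQ : 0 < Q) (hS : 0 < S)
    (hA : A2 = KA^2 * ((a*y*z)^2 / (16 * (N*P*Q*S))))
    (hB : B2 = KB^2 * ((b*x*z)^2 / (16 * (N*P*Q*S))))
    (hC : C2 = KC^2 * ((c*x*y)^2 / (16 * (N*P*Q*S)))) :
    (KA * KB * KC / 16 * (x * y * z / (N*P*Q*S)))^3 =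
      2 * k^3 / (a^2 * x) * (2 * k^3 / (b^2 * y)) * (2 * k^3 / (c^2 * z)) /
      (2 * k^3 / (A2 * KA) * (2 * k^3 / (B2 * KB)) * (2 * k^3 / (C2 * KC))) := by
  have hD : 0 < N*P*Q*S := by positivity
  generalize N*P*Q*S = D at *
  subst hA hB hC
  field_simp

/-- for `a, b, c > 1`, the absolute value of the Jacobian determinant of
`Ψ` at `(a,b,c)` equals `f(a)f(b)f(c) / (f(A)f(B)f(C))` where `(A,B,C) = Ψ(a,b,c)`;
i.e. `f(a)f(b)f(c) da db dc = f(A)f(B)f(C) dA dB dC`. -/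
theorem stmt8 (a b c : ℝ) (ha : 1 < a) (hb : 1 < b) (hc : 1 < c) :
    |(fderiv ℝ Psi (a, b, c)).det| =
      fdens a * fdens b * fdens c /
        (fdens (Psi (a, b, c)).1 * fdens (Psi (a, b, c)).2.1 *
          fdens (Psi (a, b, c)).2.2) := by
  have hA := one_lt_hexA a b c ha hb hc
  have hB := one_lt_hexA b a c hb ha hc
  have hC := one_lt_hexA c a b hc ha hb
  change _ = fdens a * fdens b * fdens c /
    (fdens (hexA a b c) * fdens (hexA b a c) * fdens (hexA c a b))
  have := fdens_pos _ ha
  have := fdens_pos _ hb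
  have := fdens_pos _ hc
  have := fdens_pos _ hA
  have := fdens_pos _ hB
  have := fdens_pos _ hC
  refine (pow_left_inj₀ (abs_nonneg _) (by positivity) (show 3 ≠ 0 by norm_num)).mp ?_
  have sA := hexA_sq a b c ha hb hc
  have sB := hexA_sq b a c hb ha hc
  have sC := hexA_sq c a b hc ha hb
  have e : (fdens a * fdens b * fdens c /
      (fdens (hexA a b c) * fdens (hexA b a c) * fdens (hexA c a b)))^3 =
      fdens a^3 * fdens b^3 * fdens c^3 /
      (fdens (hexA a b c)^3 * fdens (hexA b a c)^3 * fdens (hexA c a b)^3) := by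
    field_simp
  rw [det_Psi a b c ha hb hc, e,
    fdens_cube _ ha, fdens_cube _ hb, fdens_cube _ hc, fdens_cube _ hA, fdens_cube _ hB,
    fdens_cube _ hC]
  have kA : 0 < (hexA a b c)^2-1 := sq_sub_one_pos hA
  have kB : 0 < (hexA b a c)^2-1 := sq_sub_one_pos hB
  have kC : 0 < (hexA c a b)^2-1 := sq_sub_one_pos hC
  have a1 : 0 < a^2-1 := sq_sub_one_pos ha
  have b1 : 0 < b^2-1 := sq_sub_one_pos hb
  have c1 : 0 < c^2-1 := sq_sub_one_pos hc
  have h0 := hexConst_pos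
  have hQ : 0 < b + a*c := by positivity
  have hS : 0 < c + a*b := by positivity
  have hP : 0 < a + b*c := by positivity
  have hN : 0 < 1 + a*b*c := by positivity
  rw [show 1+b*a*c = 1+a*b*c by ring, show c+b*a = c+a*b by ring] at sB
  rw [show 1+c*a*b = 1+a*b*c by ring, show b+c*a = b+a*c by ring,
    show a+c*b = a+b*c by ring] at sC
  exact final_algebra (by linarith) (by linarith) (by linarith) kA kB kC a1 b1 c1 h0 hN hP hQ hS
    sA (sB.trans (by ring)) (sC.trans (by ring))
end
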